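/- Let p be a prime, n ≥ 1, q = p^n, k a divisor of n, v > 1 a divisor of p^k − 1, and let U be an 𝔽_{p^k}-subspace of 𝔽_q with 1 ∈ U and #U^v > 2. Assume that U^v is not the underlying set of any subfield of 𝔽_q. Let F ∈ 𝒫(U^v, q), and let γ₀ ∈ V_F be such that #{x ∈ 𝔽_q : F(x) = γ₀} ≤ #{x ∈ 𝔽_q : F(x) = γ} for every γ ∈ V_F. Then γ₀ = 0. -/

import Mathlib

open Polynomial

/-- The value set of a polynomial over a finite field. -/
def valueSet {F : Type*} [Field F] [Fintype F] [DecidableEq F] (f : F[X]) : Finset F :=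
  Finset.image (fun a => f.eval a) Finset.univ

/-- A minimal value set polynomial (MVSP): a nonconstant polynomial whose value set has
the minimal possible size `⌊(q-1)/deg f⌋ + 1`. -/
def IsMVSP {F : Type*} [Field F] [Fintype F] [DecidableEq F] (f : F[X]) : Prop :=
  0 < f.natDegree ∧ (valueSet f).card = (Fintype.card F - 1) / f.natDegree + 1

/-- `MVSPset S` is the set `𝒫(S, q)` of all MVSPs with value set `S`. -/
def MVSPset {F : Type*} [Field F] [Fintype F] [DecidableEq F] (S : Finset F) : Set F[X] :=
  {f | IsMVSP f ∧ valueSet f = S}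

/-- `U` is a subspace over the subfield `{c : c ^ r = c}` (with `r = p ^ k`):
an additive subgroup closed under multiplication by elements of that subfield. -/
def IsSubspaceOver {F : Type*} [Field F] (r : ℕ) (U : Set F) : Prop :=
  (0 : F) ∈ U ∧ (∀ x ∈ U, ∀ y ∈ U, x + y ∈ U) ∧ (∀ x ∈ U, -x ∈ U) ∧
    (∀ c : F, c ^ r = c → ∀ x ∈ U, c * x ∈ U)

/-- An `r`-linearized polynomial (with `r = q` or `r = p ^ k`): of the form `Σ aᵢ x ^ (r ^ i)`. -/
def IsLinearized {F : Type*} [Field F] (r : ℕ) (M : F[X]) : Prop :=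
  ∃ (s : ℕ) (a : ℕ → F), M = ∑ i ∈ Finset.range (s + 1), C (a i) * X ^ r ^ i

lemma aux_choose (p s i : ℕ) (hp : p.Prime) : (p ^ s * i).choose (p ^ s) ≡ i [MOD p] := by
  have := Fact.mk hp
  induction s with
  | zero => simp; rfl
  | succ s ih =>
    have h := Choose.choose_modEq_choose_mod_mul_choose_div_nat (n := p ^ (s+1) * i) (k := p ^ (s+1)) (p := p)
    have e1 : p ^ (s+1) * i = p * (p ^ s * i) := by ring
    have e2 : p ^ (s+1) = p * p ^ s := by ring
    rw [e1, e2] at h ⊢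
    simp only [Nat.mul_mod_right, Nat.choose_self, one_mul, Nat.mul_div_cancel_left _ hp.pos] at h
    exact h.trans ih

lemma aux_taylor {F : Type} [Field F] [DecidableEq F] (U : Finset F)
    (h0 : (0 : F) ∈ U) (hadd : ∀ x ∈ U, ∀ y ∈ U, x + y ∈ U) (hneg : ∀ x ∈ U, -x ∈ U)
    (M : F[X]) (hM : M = ∏ u ∈ U, (X - C u)) (t : F) :
    taylor t M = M + C (M.eval t) := by
  have hmon : M.Monic := by rw [hM]; exact monic_prod_of_monic _ _ (fun i _ => monic_X_sub_C i)
  have hdeg : M.natDegree = U.card := by rw [hM]; exact natDegree_finsetProd_X_sub_C_eq_card U id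
  have hdegp : 0 < U.card := Finset.card_pos.2 ⟨0, h0⟩
  have hper : ∀ u ∈ U, M.eval (u + t) = M.eval t := by
    intro u hu
    rw [hM, eval_prod, eval_prod]
    refine Finset.prod_bij' (fun x _ => x - u) (fun x _ => x + u) ?_ ?_ ?_ ?_ ?_
    · intro a ha; rw [sub_eq_add_neg]; exact hadd _ ha _ (hneg _ hu)
    · intro a ha; exact hadd _ ha _ hu
    · intros; ring
    · intros; ring
    · intros; simp; ring
  have hr : ∀ u ∈ U, M.eval u = 0 := by
    intro u hu
    rw [hM, eval_prod]
    exact Finset.prod_eq_zero hu (by simp)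
  rw [← sub_eq_zero]
  apply Polynomial.eq_zero_of_natDegree_lt_card_of_eval_eq_zero' _ U
  · intro u hu
    simp [taylor_eval, hper u hu, hr u hu]
  · have : (taylor t M - (M + C (M.eval t))) = (taylor t M - M) - C (M.eval t) := by ring
    rw [this, natDegree_sub_C]
    have hd : (taylor t M - M).degree < (taylor t M).degree := by
      apply degree_sub_lt_left
      · rw [degree_taylor]
      · intro h; rw [taylor_eq_zero] at h; exact hmon.ne_zero h
      · rw [leadingCoeff_taylor]
    rw [degree_taylor, degree_eq_natDegree hmon.ne_zero, hdeg] at hd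
    by_cases hz : taylor t M - M = 0
    · rw [hz]; simpa using hdegp
    · exact (natDegree_lt_iff_degree_lt hz).2 hd

lemma aux_M {F : Type} [Field F] [Fintype F] [DecidableEq F] (p k : ℕ) (hp : p.Prime) [CharP F p]
    (U : Finset F) (c : F) (hc : orderOf c = p ^ k - 1) (hc0 : c ≠ 0)
    (h0 : (0 : F) ∈ U) (hadd : ∀ x ∈ U, ∀ y ∈ U, x + y ∈ U) (hneg : ∀ x ∈ U, -x ∈ U)
    (hmul : ∀ x ∈ U, c * x ∈ U) (hmul' : ∀ x ∈ U, c⁻¹ * x ∈ U)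
    (M : F[X]) (hM : M = ∏ u ∈ U, (X - C u)) :
    M.coeff 0 = 0 ∧ M.coeff 1 ≠ 0 ∧ ∀ i, M.coeff i ≠ 0 → i ≠ 1 → p ^ k ∣ i := by
  have hmon : M.Monic := by rw [hM]; exact monic_prod_of_monic _ _ (fun i _ => monic_X_sub_C i)
  have hdeg : M.natDegree = U.card := by rw [hM]; exact natDegree_finsetProd_X_sub_C_eq_card U id
  have hM0 : M.coeff 0 = 0 := by
    rw [coeff_zero_eq_eval_zero, hM, eval_prod]
    exact Finset.prod_eq_zero h0 (by simp)
  have hM1 : M.coeff 1 ≠ 0 := by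
    have : M = X * ∏ u ∈ U.erase 0, (X - C u) := by
      rw [hM, ← Finset.mul_prod_erase U _ h0]; simp
    rw [this, coeff_X_mul, coeff_zero_eq_eval_zero, eval_prod, Finset.prod_ne_zero_iff]
    intro a ha
    simpa using (Finset.mem_erase.1 ha).1
  have hhasse : ∀ j, 1 ≤ j → hasseDeriv j M = C (M.coeff j) := by
    intro j hj
    rw [← sub_eq_zero]
    apply Polynomial.eq_zero_of_natDegree_lt_card_of_eval_eq_zero' _ Finset.univ
    · intro t _
      have := congrArg (fun P => P.coeff j) (aux_taylor U h0 hadd hneg M hM t)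
      simp only [taylor_coeff, coeff_add, coeff_C, if_neg (show j ≠ 0 by lia)] at this
      simp [this]
    · rw [natDegree_sub_C]
      refine lt_of_le_of_lt (natDegree_hasseDeriv_le _ _) ?_
      rw [hdeg]
      have := Finset.card_le_univ U
      have h2 : 0 < U.card := Finset.card_pos.2 ⟨0, h0⟩
      rw [Finset.card_univ]; omega
  refine ⟨hM0, hM1, ?_⟩
  intro i hi hi1
  have hi0 : i ≠ 0 := by rintro rfl; exact hi hM0
  obtain ⟨s, m, hpm, hs⟩ := Nat.exists_eq_pow_mul_and_not_dvd hi0 p hp.ne_one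
  have him : m = 1 := by
    by_contra hm1
    have hmpos : 0 < m := Nat.pos_of_ne_zero (by rintro rfl; simp at hpm)
    have hps : 0 < p ^ s := Nat.pow_pos hp.pos
    have hlt : p ^ s < i := by rw [hs]; nlinarith [show 2 ≤ m by omega]
    have := congrArg (fun P => P.coeff (i - p ^ s)) (hhasse (p ^ s) hps)
    simp only [hasseDeriv_coeff, coeff_C, if_neg (show i - p ^ s ≠ 0 by omega),
      Nat.sub_add_cancel hlt.le] at this
    rcases mul_eq_zero.1 this with h | h
    · rw [CharP.cast_eq_zero_iff F p, hs] at h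
      exact hpm ((Nat.ModEq.dvd_iff (aux_choose p s m hp) dvd_rfl).1 h)
    · exact hi h
  rw [him, mul_one] at hs
  have hsc : ∀ i, c ^ i * M.coeff i = c ^ U.card * M.coeff i := by
    have : M.comp (C c * X) = C (c ^ U.card) * M := by
      rw [hM, prod_comp, C_pow, ← Finset.prod_const, ← Finset.prod_mul_distrib]
      refine Finset.prod_bij' (fun x _ => c⁻¹ * x) (fun x _ => c * x) (fun a ha => hmul' a ha)
        (fun a ha => hmul a ha) ?_ ?_ ?_
      · intros; field_simp
      · intros; field_simp
      · intro a ha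
        simp only [sub_comp, X_comp, C_comp, mul_sub, ← C_mul]
        rw [mul_inv_cancel_left₀ hc0]
    intro i
    have := congrArg (fun P => P.coeff i) this
    simp only [comp_C_mul_X_coeff, coeff_C_mul] at this
    rw [mul_comm, this]
  have e1 : c ^ 1 = c ^ U.card := mul_right_cancel₀ hM1 (hsc 1)
  have e2 : c ^ i = c ^ U.card := mul_right_cancel₀ hi (hsc i)
  have e3 : c ^ (i - 1) = 1 := by
    have : c ^ (i-1) * c = 1 * c := by
      rw [← pow_succ, Nat.sub_add_cancel (by omega), e2, ← e1]; simp
    exact mul_right_cancel₀ hc0 this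
  have e4 := orderOf_dvd_of_pow_eq_one e3
  rw [hc] at e4
  have e5 := Nat.le_of_dvd (by omega) e4
  rw [hs] at e5 ⊢
  apply pow_dvd_pow
  rw [← Nat.pow_le_pow_iff_right hp.one_lt]
  have : 0 < p ^ s := Nat.pow_pos hp.pos
  omega

lemma aux_T {F : Type} [Field F] [DecidableEq F] (v : ℕ) (hv : 1 < v)
    (U : Finset F) (ζ : F) (hζ : IsPrimitiveRoot ζ v)
    (h0 : (0 : F) ∈ U) (hmul : ∀ x ∈ U, ζ * x ∈ U) :
    expand F v (∏ γ ∈ U.image (fun u => u ^ v), (X - C γ)) =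
      X ^ (v - 1) * ∏ u ∈ U, (X - C u) := by
  have hz : ∀ i, ∀ x ∈ U, ζ ^ i * x ∈ U := by
    intro i
    induction i with
    | zero => intro x hx; simpa
    | succ i ih => intro x hx; rw [pow_succ', mul_assoc]; exact hmul _ (ih x hx)
  have h0V : (0 : F) ∈ U.image (fun u => u ^ v) :=
    Finset.mem_image.2 ⟨0, h0, by simp; omega⟩
  rw [← Finset.prod_fiberwise_of_maps_to (s := U) (t := U.image (fun u => u ^ v))
    (g := fun u => u ^ v) (fun x hx => Finset.mem_image_of_mem _ hx)]
  rw [map_prod, ← Finset.mul_prod_erase _ _ h0V, ← Finset.mul_prod_erase _ _ h0V, ← mul_assoc]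
  congr 1
  · have : {u ∈ U | u ^ v = 0} = {(0:F)} := by
      ext x
      simp only [Finset.mem_filter, Finset.mem_singleton, pow_eq_zero_iff (show v ≠ 0 by omega)]
      constructor
      · exact fun h => h.2
      · rintro rfl; exact ⟨h0, rfl⟩
    rw [this]
    simp only [C_0, sub_zero, expand_X, Finset.prod_singleton]
    rw [← pow_succ, Nat.sub_add_cancel (by omega)]
  · apply Finset.prod_congr rfl
    intro γ hγ
    obtain ⟨hγ0, hγ⟩ := Finset.mem_erase.1 hγ
    obtain ⟨u, hu, rfl⟩ := Finset.mem_image.1 hγ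
    have hu0 : u ≠ 0 := by rintro rfl; apply hγ0; simp; omega
    simp only [map_sub, expand_X, expand_C]
    rw [X_pow_sub_C_eq_prod hζ (by omega) (rfl : u ^ v = u ^ v)]
    refine Finset.prod_bij (fun i _ => ζ ^ i * u) ?_ ?_ ?_ ?_
    · intro i _
      rw [Finset.mem_filter]
      exact ⟨hz i u hu, by rw [mul_pow, ← pow_mul, mul_comm i, pow_mul, hζ.pow_eq_one]; simp⟩
    · intro i hi j hj h
      exact hζ.pow_inj (Finset.mem_range.1 hi) (Finset.mem_range.1 hj) (mul_right_cancel₀ hu0 h)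
    · intro b hb
      obtain ⟨hb, hbu⟩ := Finset.mem_filter.1 hb
      have : NeZero v := ⟨by omega⟩
      obtain ⟨i, hi, hi2⟩ := hζ.eq_pow_of_pow_eq_one (ξ := b / u)
        (by rw [div_pow, hbu]; exact div_self (pow_ne_zero _ hu0))
      exact ⟨i, Finset.mem_range.2 hi, by rw [hi2]; field_simp⟩
    · intros; rfl

lemma aux_Tcoef {F : Type} [Field F] (v N : ℕ) (hv : 1 < v) (T M : F[X])
    (h : expand F v T = X ^ (v - 1) * M) (hM1 : M.coeff 1 ≠ 0)
    (hM : ∀ i, M.coeff i ≠ 0 → i ≠ 1 → N ∣ i) :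
    T.coeff 0 = 0 ∧ T.coeff 1 ≠ 0 ∧
      ∀ m, T.coeff m ≠ 0 → m ≠ 1 → ∃ i, v * m = N * i + (v - 1) := by
  have key : ∀ m, T.coeff (m + 1) = M.coeff (v * m + 1) := by
    intro m
    rw [← coeff_expand_mul' (show 0 < v by omega) T (m+1), h,
      show v * (m + 1) = v * m + 1 + (v - 1) by rw [mul_add]; omega, coeff_X_pow_mul]
  have h0 : T.coeff 0 = 0 := by
    rw [← coeff_expand_mul' (show 0 < v by omega) T 0, h, mul_zero, coeff_X_pow_mul', if_neg (by omega)]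
  refine ⟨h0, by simpa using (key 0).trans_ne (by simpa using hM1), ?_⟩
  intro m hm hm1
  obtain ⟨m, rfl⟩ : ∃ m', m = m' + 1 := ⟨m - 1, by
    have : m ≠ 0 := by rintro rfl; exact hm h0
    omega⟩
  rw [key] at hm
  have hm0 : m ≠ 0 := by omega
  obtain ⟨i, hi⟩ := hM _ hm (by simp; omega)
  exact ⟨i, by rw [← hi, mul_add]; omega⟩

lemma aux_H {F : Type} [Field F] [Fintype F] (T f : F[X]) (hd : 0 < f.natDegree)
    (hT : T.natDegree = (Fintype.card F - 1) / f.natDegree + 1)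
    (hz : ∀ a, T.eval (f.eval a) = 0) :
    ∃ H : F[X], T.comp f = (X ^ Fintype.card F - X) * H ∧ H.natDegree < f.natDegree ∧
      ∀ a, T.derivative.eval (f.eval a) * f.derivative.eval a = - H.eval a := by
  have hq : 1 < Fintype.card F := Fintype.one_lt_card
  have hmon : (X ^ Fintype.card F - X : F[X]).Monic := monic_X_pow_sub (by
    rw [degree_X]; exact_mod_cast hq)
  have hdeg := FiniteField.X_pow_card_sub_X_natDegree_eq F hq
  have hdvd : (X ^ Fintype.card F - X : F[X]) ∣ T.comp f := by
    rw [← modByMonic_eq_zero_iff_dvd hmon]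
    apply Polynomial.eq_zero_of_natDegree_lt_card_of_eval_eq_zero' _ Finset.univ
    · intro a _
      have := congrArg (eval a) (modByMonic_add_div (T.comp f) (X ^ Fintype.card F - X : F[X]))
      simpa [FiniteField.pow_card, hz] using this
    · rw [Finset.card_univ]
      calc _ < (X ^ Fintype.card F - X : F[X]).natDegree := natDegree_modByMonic_lt _ hmon (by
              intro h; rw [h, natDegree_one] at hdeg; omega)
        _ = _ := hdeg
  obtain ⟨H, hH⟩ := hdvd
  have hne : T.comp f ≠ 0 := by
    intro h
    have := natDegree_comp (p := T) (q := f)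
    rw [h, hT, natDegree_zero] at this
    have h2 := Nat.mul_pos (Nat.succ_pos ((Fintype.card F - 1) / f.natDegree)) hd
    simp only [Nat.succ_eq_add_one] at h2
    omega
  refine ⟨H, hH, ?_, ?_⟩
  · have hH0 : H ≠ 0 := by rintro rfl; exact hne (by simpa using hH)
    have h1 := congrArg natDegree hH
    rw [natDegree_comp, natDegree_mul hmon.ne_zero hH0, hdeg, hT, add_mul, one_mul] at h1
    have := Nat.div_mul_le_self (Fintype.card F - 1) f.natDegree
    omega
  · intro a
    have h1 := congrArg (fun P => eval a (derivative P)) hH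
    simp only [derivative_comp, derivative_mul, eval_mul, eval_add, eval_comp, derivative_sub,
      derivative_X_pow, derivative_X, eval_sub, eval_pow, eval_X, FiniteField.pow_card, sub_self,
      zero_mul, add_zero, eval_C, FiniteField.cast_card_eq_zero, eval_one] at h1
    rw [mul_comm, h1]
    ring

lemma aux_final {F : Type} [Field F] [Fintype F] [DecidableEq F] (f : F[X]) (hf : IsMVSP f)
    (hcard : 2 < (valueSet f).card) (h0 : 0 ∈ valueSet f)
    (hd : ∀ a, f.eval a = 0 → f.derivative.eval a = 0)
    (γ₀ : F) (hγ₀ : γ₀ ∈ valueSet f)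
    (hmin : (Finset.univ.filter (fun x : F => f.eval x = γ₀)).card ≤
        (Finset.univ.filter (fun x : F => f.eval x = 0)).card) :
    γ₀ = 0 := by
  by_contra hne
  have hd0 := hf.1
  have hfne : ∀ γ, f - C γ ≠ 0 := by
    intro γ h
    have := natDegree_sub_C (p := f) (a := γ)
    rw [h, natDegree_zero] at this; omega
  have hle : ∀ γ, (Finset.univ.filter (fun x : F => f.eval x = γ)).card ≤ f.natDegree := by
    intro γ
    rw [← natDegree_sub_C (p := f) (a := γ)]
    apply card_le_degree_of_subset_roots
    intro x hx
    rw [mem_roots (hfne γ)]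
    simp at hx
    simp [hx]
  have h2 : 2 * (Finset.univ.filter (fun x : F => f.eval x = 0)).card ≤ f.natDegree := by
    have hf0 : f ≠ 0 := by simpa using hfne 0
    refine le_trans ?_ (card_roots' f)
    have : (2 • (Finset.univ.filter (fun x : F => f.eval x = 0)).val) ≤ f.roots := by
      rw [Multiset.le_iff_count]
      intro a
      rw [Multiset.count_nsmul, count_roots]
      by_cases ha : f.eval a = 0
      · have h1 := (one_lt_rootMultiplicity_iff_isRoot hf0).2 ⟨ha, hd a ha⟩
        have := Multiset.nodup_iff_count_le_one.1 (Finset.univ.filter (fun x : F => f.eval x = 0)).nodup a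
        omega
      · rw [Multiset.count_eq_zero_of_notMem]; · simp
        simpa using ha
    have := Multiset.card_le_card this
    rw [Multiset.card_nsmul] at this
    exact this
  have hsum : Fintype.card F = ∑ γ ∈ valueSet f, (Finset.univ.filter (fun x : F => f.eval x = γ)).card := by
    rw [← Finset.card_univ]
    apply Finset.card_eq_sum_card_fiberwise
    intro x _
    simp [valueSet]
  have hγ' : γ₀ ∈ (valueSet f).erase 0 := Finset.mem_erase.2 ⟨hne, hγ₀⟩
  rw [← Finset.add_sum_erase _ _ h0, ← Finset.add_sum_erase _ _ hγ'] at hsum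
  have h3 := Finset.sum_le_card_nsmul (((valueSet f).erase 0).erase γ₀)
    (fun γ => (Finset.univ.filter (fun x : F => f.eval x = γ)).card) _ (fun γ _ => hle γ)
  rw [Finset.card_erase_of_mem hγ', Finset.card_erase_of_mem h0, smul_eq_mul] at h3
  have h4 := hf.2
  have h5 := Nat.div_mul_le_self (Fintype.card F - 1) f.natDegree
  have h6 : (Fintype.card F - 1) / f.natDegree = (valueSet f).card - 2 + 1 := by omega
  rw [h6, add_mul] at h5
  have : (valueSet f).card - 1 - 1 = (valueSet f).card - 2 := by omega
  rw [this] at h3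
  have := Fintype.card_pos (α := F)
  omega

lemma aux_vanish {F : Type} [Field F] [Fintype F] [DecidableEq F] (f P : F[X])
    (hd : 0 < f.natDegree) (hP : ∀ a, f.eval a ≠ 0 → P.eval a = 0)
    (hdeg : P.natDegree + f.natDegree < Fintype.card F) : P = 0 := by
  apply Polynomial.eq_zero_of_natDegree_lt_card_of_eval_eq_zero' _
    (Finset.univ.filter (fun x : F => f.eval x ≠ 0))
  · intro a ha
    exact hP a (by simpa using ha)
  · have h1 := Finset.card_filter_add_card_filter_not (s := (Finset.univ : Finset F)) (fun x : F => f.eval x = 0)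
    have h2 : (Finset.univ.filter (fun x : F => f.eval x = 0)).card ≤ f.natDegree := by
      apply card_le_degree_of_subset_roots
      intro x hx
      rw [mem_roots (by rintro rfl; simp at hd)]
      simpa using hx
    rw [Finset.card_univ] at h1
    simp only [ne_eq]
    omega

lemma aux_ode {F : Type} [Field F] (p k v : ℕ) [CharP F p] (hk : k ≠ 0) (hv : 1 < v)
    (T : F[X]) (h0 : T.coeff 0 = 0)
    (hs : ∀ m, T.coeff m ≠ 0 → m ≠ 1 → ∃ i, v * m = p ^ k * i + (v - 1)) (y : F)
    (hy : T.eval y = 0) (hy0 : y ≠ 0) :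
    (v : F) * T.derivative.eval y = T.coeff 1 := by
  have ode : C (v : F) * (X * derivative T) = C ((v : F) - 1) * T + C (T.coeff 1) * X := by
    ext m
    rcases m with _ | m
    · simp [h0]
    · simp only [coeff_C_mul, coeff_X_mul, coeff_derivative, coeff_add, coeff_X]
      by_cases hm : m = 0
      · subst hm; simp; ring
      · rw [if_neg (by omega), mul_zero, add_zero]
        by_cases ht : T.coeff (m + 1) = 0
        · simp [ht]
        · obtain ⟨i, hi⟩ := hs _ ht (by omega)
          have := congrArg (Nat.cast : ℕ → F) hi
          push_cast [Nat.cast_sub hv.le] at this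
          rw [CharP.cast_eq_zero F p, zero_pow hk, zero_mul, zero_add] at this
          rw [← this]; ring
  have := congrArg (eval y) ode
  simp only [eval_mul, eval_C, eval_X, eval_add, hy, mul_zero, zero_add] at this
  apply mul_right_cancel₀ hy0
  rw [← this]; ring

/-- coefficient of `p^e` in the Taylor expansion -/
lemma aux_hasse {F : Type} [Field F] [Fintype F] (p e : ℕ) (hp : p.Prime) [CharP F p] (he : e ≠ 0)
    (hpe : p ^ e < Fintype.card F) (f Q : F[X]) (c s : F)
    (h : C c * f + (expand F (p ^ e) Q).comp f = C s * ((X ^ Fintype.card F - X) * derivative f))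
    (a : F) :
    c * (hasseDeriv (p ^ e) f).eval a +
      Q.derivative.eval (f.eval a ^ p ^ e) * f.derivative.eval a ^ p ^ e = 0 := by
  have := Fact.mk hp
  have hpos : 0 < p ^ e := Nat.pow_pos hp.pos
  set P := taylor a f with hP
  have hc : ∀ g : F[X], taylor a g = g.comp (X + C a) := fun g => taylor_apply a g
  have h1 : C c * P + (expand F (p ^ e) Q).comp P
      = C s * ((X ^ Fintype.card F - X) * derivative P) := by
    have := congrArg (fun g => g.comp (X + C a)) h
    have e1 : ((X : F[X]) + C a) ^ Fintype.card F - (X + C a) = X ^ Fintype.card F - X := by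
      obtain ⟨n, -, hn⟩ := FiniteField.card F p
      rw [hn, add_pow_char_pow, ← C_pow, ← hn, FiniteField.pow_card]; ring
    simp only [add_comp, mul_comp, C_comp, comp_assoc, sub_comp, X_pow_comp, X_comp, e1] at this
    rw [hP, hc, this, derivative_comp]
    simp
  have h2 : (expand F (p ^ e) Q).comp P = expand F (p ^ e) (Q.comp (P.map (iterateFrobenius F p e))) := by
    rw [expand_eq_comp_X_pow, comp_assoc, X_pow_comp, ← map_iterateFrobenius_expand p P e,
      map_expand, expand_eq_comp_X_pow, expand_eq_comp_X_pow, comp_assoc]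
  have h3 := congrArg (fun g => g.coeff (p ^ e)) h1
  simp only [h2, coeff_add, coeff_C_mul, sub_mul, coeff_sub] at h3
  rw [coeff_X_pow_mul', if_neg (by omega)] at h3
  obtain ⟨N, hN⟩ : ∃ N, p ^ e = N + 1 := ⟨p ^ e - 1, by omega⟩
  have h4 : (X * derivative P).coeff (p ^ e) = 0 := by
    have : ((p ^ e : ℕ) : F) = 0 := by
      rw [Nat.cast_pow, CharP.cast_eq_zero, zero_pow he]
    rw [hN] at this ⊢
    rw [coeff_X_mul, coeff_derivative]
    push_cast at this
    rw [this, mul_zero]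
  have h5 : (expand F (p ^ e) (Q.comp (P.map (iterateFrobenius F p e)))).coeff (p ^ e) =
      Q.derivative.eval (f.eval a ^ p ^ e) * f.derivative.eval a ^ p ^ e := by
    rw [show (expand F (p ^ e) (Q.comp (P.map (iterateFrobenius F p e)))).coeff (p ^ e) =
      (expand F (p ^ e) (Q.comp (P.map (iterateFrobenius F p e)))).coeff (p ^ e * 1) by rw [mul_one],
      coeff_expand_mul' hpos]
    have : ∀ g : F[X], g.coeff 1 = g.derivative.eval 0 := by
      intro g; rw [← coeff_zero_eq_eval_zero, coeff_derivative]; simp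
    rw [this, derivative_comp, eval_mul, eval_comp, derivative_map, ← coeff_zero_eq_eval_zero,
      ← coeff_zero_eq_eval_zero, coeff_map, coeff_map, iterateFrobenius_def, iterateFrobenius_def,
      coeff_derivative, hP, taylor_coeff_zero, zero_add, taylor_coeff_one]
    simp [mul_comm]
  rw [h4, h5, hP, taylor_coeff] at h3
  rw [h3]; ring

lemma aux_Q {F : Type} [Field F] (p k v e w : ℕ) (hp : p.Prime) [CharP F p] (hv : 1 < v)
    (he : e ≠ 0) (hek : e < k) (hvw : v - 1 = p ^ e * w)
    (T : F[X]) (h0 : T.coeff 0 = 0)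
    (hs : ∀ m, T.coeff m ≠ 0 → m ≠ 1 → ∃ i, v * m = p ^ k * i + (v - 1)) :
    (∀ m, T.coeff m ≠ 0 → m ≠ 1 → p ^ e ∣ m) ∧
    ∃ Q : F[X], T = C (T.coeff 1) * X + expand F (p ^ e) Q ∧ X * derivative Q = C (w : F) * Q := by
  have hpos : 0 < p ^ e := Nat.pow_pos hp.pos
  have hpe1 : 1 < p ^ e := Nat.one_lt_pow he hp.one_lt
  have hke : p ^ k = p ^ e * p ^ (k - e) := by rw [← pow_add]; congr 1; omega
  have hv1 : v = p ^ e * w + 1 := by omega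
  have hcop : Nat.Coprime (p ^ e) v := by
    rw [hv1]; simp
  have hdvd : ∀ m, T.coeff m ≠ 0 → m ≠ 1 → p ^ e ∣ m := by
    intro m hm hm1
    obtain ⟨i, hi⟩ := hs m hm hm1
    apply hcop.dvd_of_dvd_mul_left
    rw [hi, hvw, hke, mul_assoc, ← mul_add]
    exact dvd_mul_right _ _
  refine ⟨hdvd, contract (p ^ e) (T - C (T.coeff 1) * X), ?_, ?_⟩
  · ext m
    rw [coeff_add, coeff_expand hpos, coeff_C_mul, coeff_X]
    by_cases hm : m = 1
    · subst hm
      rw [if_pos rfl, if_neg (by rw [Nat.dvd_one]; omega)]; simp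
    · rw [if_neg (fun h => hm h.symm), mul_zero, zero_add]
      split_ifs with h
      · rw [coeff_contract hpos.ne', Nat.div_mul_cancel h, coeff_sub, coeff_C_mul, coeff_X,
          if_neg (fun h => hm h.symm)]
        simp
      · by_contra hne; exact h (hdvd m hne hm)
  · ext m
    rcases m with _ | j
    · simp [coeff_contract hpos.ne', h0]
    · rw [coeff_X_mul, coeff_derivative, coeff_C_mul, coeff_contract hpos.ne', coeff_sub, coeff_C_mul,
        coeff_X, if_neg (by intro h; have := Nat.eq_one_of_mul_eq_one_left h.symm; omega), mul_zero, sub_zero]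
      by_cases ht : T.coeff ((j + 1) * p ^ e) = 0
      · simp [ht]
      · obtain ⟨i, hi⟩ := hs _ ht (by intro h; have := Nat.eq_one_of_mul_eq_one_left h; omega)
        have h2 : v * (j + 1) = p ^ (k - e) * i + w := by
          apply Nat.eq_of_mul_eq_mul_left hpos
          rw [hvw, hke] at hi
          linarith
        have h3 := congrArg (Nat.cast : ℕ → F) h2
        rw [hv1] at h3
        push_cast at h3
        rw [CharP.cast_eq_zero F p, zero_pow he, zero_pow (by omega)] at h3
        simp only [zero_mul, zero_add, one_mul] at h3
        rw [h3]; ring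

theorem stmt_core (p n k v : ℕ) (hp : p.Prime) (hn : 0 < n) (hk : k ∣ n)
    (hv : 1 < v) (hvd : v ∣ p ^ k - 1)
    (F : Type) [Field F] [Fintype F] [DecidableEq F] [CharP F p]
    (hcard : Fintype.card F = p ^ n)
    (V : Finset F) (T : F[X]) (hT : T = ∏ γ ∈ V, (X - C γ)) (h0V : 0 ∈ V) (h1V : 1 ∈ V)
    (h0 : T.coeff 0 = 0) (h1 : T.coeff 1 ≠ 0)
    (hs : ∀ m, T.coeff m ≠ 0 → m ≠ 1 → ∃ i, v * m = p ^ k * i + (v - 1))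
    (hUv : 2 < V.card)
    (hnotfield : ¬ ∃ K : Subfield F, (↑V : Set F) = (K : Set F))
    (f : F[X]) (hf : IsMVSP f) (hfV : valueSet f = V) :
    ∀ a, f.eval a = 0 → f.derivative.eval a = 0 := by
  have := Fact.mk hp
  have hk0 : k ≠ 0 := by rintro rfl; rw [zero_dvd_iff] at hk; omega
  have hd := hf.1
  have hr := hf.2
  rw [hfV] at hr
  have hTmon : T.Monic := by rw [hT]; exact monic_prod_of_monic _ _ (fun i _ => monic_X_sub_C i)
  have hTdeg : T.natDegree = V.card := by rw [hT]; exact natDegree_finsetProd_X_sub_C_eq_card V id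
  have hroot : ∀ y, T.eval y = 0 ↔ y ∈ V := by
    intro y
    rw [hT, eval_prod, Finset.prod_eq_zero_iff]
    constructor
    · rintro ⟨b, hb, h⟩
      rw [eval_sub, eval_X, eval_C, sub_eq_zero] at h; rwa [h]
    · intro h; exact ⟨y, h, by simp⟩
  have hfa : ∀ a, f.eval a ∈ V := by
    intro a; rw [← hfV]; simp [valueSet]
  have hpk : v ≤ p ^ k - 1 := Nat.le_of_dvd (by
    have := Nat.one_lt_pow hk0 hp.one_lt; omega) hvd
  have hvF : (v : F) ≠ 0 := by
    rw [Ne, CharP.cast_eq_zero_iff F p]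
    intro h
    have h2 : p ∣ p ^ k - 1 := h.trans hvd
    have h3 : p ∣ p ^ k := dvd_pow_self p hk0
    have h4 := (Nat.dvd_sub_iff_right (Nat.one_le_pow _ _ hp.pos) h3).1 h2
    exact hp.one_lt.ne' (Nat.dvd_one.1 h4)
  obtain ⟨H, hH, hHd, hHe⟩ := aux_H T f hd (by rw [hTdeg, hr]) (fun a => (hroot _).2 (hfa a))
  set t : F := T.coeff 1 / v with ht
  have htV : ∀ y ∈ V, y ≠ 0 → T.derivative.eval y = t := by
    intro y hy hy0
    rw [ht, ← aux_ode p k v hk0 hv T h0 hs y ((hroot y).2 hy) hy0]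
    field_simp
  -- bound on degrees
  have hbound : ∀ N, N + 2 ≤ V.card → N * f.natDegree < Fintype.card F - f.natDegree := by
    intro N hN
    have h5 := Nat.div_mul_le_self (Fintype.card F - 1) f.natDegree
    have h6 : N + 1 ≤ (Fintype.card F - 1) / f.natDegree := by omega
    have h7 := (Nat.mul_le_mul_right f.natDegree h6).trans h5
    rw [add_mul] at h7
    have := Fintype.card_pos (α := F)
    omega
  have hHf : H = C (-t) * derivative f := by
    have : C t * derivative f + H = 0 := by
      apply aux_vanish f _ hd
      · intro a ha
        have := hHe a
        rw [htV _ (hfa a) ha] at this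
        rw [eval_add, eval_mul, eval_C, this]; ring
      · have e1 : (C t * derivative f + H).natDegree ≤ f.natDegree := by
          refine (natDegree_add_le _ _).trans (max_le ?_ hHd.le)
          exact (natDegree_C_mul_le _ _).trans ((natDegree_derivative_le f).trans (Nat.sub_le _ _))
        have := hbound 1 (by omega)
        omega
    rw [C_neg, neg_mul]
    linear_combination this
  obtain ⟨e, w, hw, hvw⟩ := Nat.exists_eq_pow_mul_and_not_dvd (show v - 1 ≠ 0 by omega) p hp.ne_one
  have hwF : (w : F) ≠ 0 := by rwa [Ne, CharP.cast_eq_zero_iff F p]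
  have hw0 : w ≠ 0 := by rintro rfl; simp at hw
  have hek : e < k := by
    rw [← Nat.pow_lt_pow_iff_right hp.one_lt]
    have : p ^ e ≤ p ^ e * w := Nat.le_mul_of_pos_right _ (by omega)
    omega
  intro a ha
  by_cases he : e = 0
  · have h2 := hHe a
    have h3 : T.derivative.eval 0 = T.coeff 1 := by
      rw [← coeff_zero_eq_eval_zero, coeff_derivative]; simp
    rw [ha, h3, hHf, eval_mul, eval_C] at h2
    have h4 : (T.coeff 1 - t) * f.derivative.eval a = 0 := by linear_combination h2
    rcases mul_eq_zero.1 h4 with h | h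
    · exfalso
      rw [he, pow_zero, one_mul] at hvw
      have h5 : (v : F) = w + 1 := by
        rw [show v = w + 1 by omega]; push_cast; rfl
      have h6 : T.coeff 1 * (v - 1) = 0 := by
        rw [ht] at h
        field_simp at h
        linear_combination h
      rcases mul_eq_zero.1 h6 with h | h
      · exact h1 h
      · rw [h5] at h; exact hwF (by linear_combination h)
    · exact h
  · obtain ⟨hdvd, Q, hTQ, hQ⟩ := aux_Q p k v e w hp hv he hek hvw T h0 hs
    have hpe1 : 1 < p ^ e := Nat.one_lt_pow he hp.one_lt
    have hVd : p ^ e ∣ V.card := by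
      apply hdvd _ _ (by omega)
      rw [← hTdeg, hTmon.coeff_natDegree]; exact one_ne_zero
    have hVne : V.card ≠ p ^ e := by
      intro hVe
      apply hnotfield
      have hV : ∀ y, y ∈ V ↔ y ^ p ^ e = y := by
        have hsum : ∀ y, T.eval y = T.coeff 1 * y + y ^ p ^ e := by
          have : T = C (T.coeff 1) * X + X ^ p ^ e := by
            ext m
            rw [coeff_add, coeff_C_mul, coeff_X, coeff_X_pow]
            by_cases hm1 : m = 1
            · subst hm1; rw [if_pos rfl, if_neg (by omega)]; ring
            · rw [if_neg (fun h => hm1 h.symm)]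
              by_cases hm : m = p ^ e
              · rw [if_pos hm, hm, ← hVe, ← hTdeg, hTmon.coeff_natDegree]; ring
              · rw [if_neg hm]
                by_contra hne
                have hne : T.coeff m ≠ 0 := by simpa using hne
                have h2 := hdvd m hne hm1
                have h3 := le_natDegree_of_ne_zero hne
                rw [hTdeg, hVe] at h3
                rcases Nat.eq_zero_or_pos m with h4 | h4
                · rw [h4] at hne; exact hne h0
                · exact hm (le_antisymm h3 (Nat.le_of_dvd h4 h2))
          intro y
          conv_lhs => rw [this]
          simp
        have hc : T.coeff 1 = -1 := by
          have := (hroot 1).2 h1V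
          rw [hsum, one_pow] at this
          linear_combination this
        intro y
        rw [← hroot, hsum, hc]
        constructor
        · intro h; linear_combination h
        · intro h; linear_combination h
      refine ⟨{ carrier := V, mul_mem' := ?_, one_mem' := ?_, add_mem' := ?_, zero_mem' := ?_,
                neg_mem' := ?_, inv_mem' := ?_ }, rfl⟩
      · intro x y hx hy
        simp only [Finset.mem_coe, hV] at hx hy ⊢
        rw [mul_pow, hx, hy]
      · exact h1V
      · intro x y hx hy
        simp only [Finset.mem_coe, hV] at hx hy ⊢
        rw [add_pow_char_pow, hx, hy]
      · exact h0V
      · intro x hx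
        simp only [Finset.mem_coe, hV] at hx ⊢
        have := sub_pow_char_pow (p := p) (n := e) (0 : F) x
        rw [hx, zero_pow (by omega)] at this
        simpa using this
      · intro x hx
        simp only [Finset.mem_coe, hV] at hx ⊢
        rw [inv_pow, hx]
    have hVbig : p ^ e + 2 ≤ V.card := by
      obtain ⟨s, hs⟩ := hVd
      have : 2 ≤ s := by
        by_contra hlt
        have : s = 0 ∨ s = 1 := by omega
        rcases this with rfl | rfl
        · omega
        · omega
      nlinarith
    have hpeq : p ^ e < Fintype.card F := by
      rw [hcard]; exact Nat.pow_lt_pow_right hp.one_lt (lt_of_lt_of_le hek (Nat.le_of_dvd hn hk))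
    have hcomp : C (T.coeff 1) * f + (expand F (p ^ e) Q).comp f =
        C (-t) * ((X ^ Fintype.card F - X) * derivative f) := by
      have : T.comp f = C (T.coeff 1) * f + (expand F (p ^ e) Q).comp f := by
        conv_lhs => rw [hTQ]
        simp
      rw [← this, hH, hHf]; ring
    have hG : f ^ (p ^ e - 1) * hasseDeriv (p ^ e) f - C (w : F) * derivative f ^ p ^ e = 0 := by
      apply aux_vanish f _ hd
      · intro b hb
        have h2 := aux_hasse p e hp he hpeq f Q _ _ hcomp b
        have h3 := congrArg (eval (f.eval b ^ p ^ e)) hQ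
        have h4 := congrArg (eval (f.eval b)) hTQ
        rw [(hroot _).2 (hfa b)] at h4
        simp only [eval_mul, eval_C, eval_X, eval_add, expand_eval] at h3 h4
        simp only [eval_sub, eval_mul, eval_C, eval_pow]
        apply mul_right_cancel₀ (mul_ne_zero h1 hb)
        obtain ⟨N, hN⟩ : ∃ N, p ^ e = N + 1 := ⟨p ^ e - 1, by omega⟩
        generalize f.derivative.eval b ^ p ^ e = D at *
        generalize (hasseDeriv (p ^ e) f).eval b = E at *
        generalize eval (eval b f ^ p ^ e) (derivative Q) = Q' at *
        generalize eval (eval b f ^ p ^ e) Q = Q0 at *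
        have h5 : f.eval b ^ (p ^ e - 1) * f.eval b = f.eval b ^ p ^ e := by
          rw [← pow_succ, Nat.sub_add_cancel hpe1.le]
        generalize f.eval b ^ (p ^ e - 1) = A at *
        generalize f.eval b ^ p ^ e = B at *
        linear_combination B * h2 - D * h3 + w * D * h4 + E * T.coeff 1 * h5
      · have e1 : (f ^ (p ^ e - 1) * hasseDeriv (p ^ e) f - C (w : F) * derivative f ^ p ^ e).natDegree
            ≤ p ^ e * f.natDegree := by
          refine (natDegree_sub_le _ _).trans (max_le ?_ ?_)
          · refine natDegree_mul_le.trans ?_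
            have e2 := natDegree_pow_le (p := f) (n := p ^ e - 1)
            have e3 := (natDegree_hasseDeriv_le f (p ^ e)).trans (Nat.sub_le _ _)
            have e4 : p ^ e * f.natDegree = (p ^ e - 1) * f.natDegree + f.natDegree := by
              rw [← Nat.succ_mul]; congr 1; omega
            omega
          · refine (natDegree_C_mul_le _ _).trans (natDegree_pow_le.trans ?_)
            exact Nat.mul_le_mul_left _ ((natDegree_derivative_le f).trans (Nat.sub_le _ _))
        have := hbound (p ^ e) hVbig
        omega
    have h2 := congrArg (eval a) hG
    simp only [eval_sub, eval_mul, eval_C, eval_pow, ha, eval_zero,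
      zero_pow (show p ^ e - 1 ≠ 0 by omega), zero_mul, zero_sub, neg_eq_zero] at h2
    exact eq_zero_of_pow_eq_zero ((mul_eq_zero.1 h2).resolve_left hwF)

/-- if `v > 1`, `U^v` is not a subfield, and `F ∈ 𝒫(U^v, q)`, then the value
`γ₀ ∈ V_F` with the smallest fiber is `0`. -/
theorem stmt_19 (p n k v : ℕ) (hp : p.Prime) (hn : 0 < n) (hk : k ∣ n)
    (hv : 1 < v) (hvd : v ∣ p ^ k - 1)
    (F : Type) [Field F] [Fintype F] [DecidableEq F]
    (hcard : Fintype.card F = p ^ n)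
    (U : Finset F) (hU : IsSubspaceOver (p ^ k) (↑U : Set F)) (h1 : (1 : F) ∈ U)
    (hUv : 2 < (U.image (fun u => u ^ v)).card)
    (hnotfield : ¬ ∃ K : Subfield F, (↑(U.image (fun u => u ^ v)) : Set F) = (K : Set F))
    (f : F[X]) (hf : f ∈ MVSPset (U.image (fun u => u ^ v)))
    (γ₀ : F) (hγ₀ : γ₀ ∈ valueSet f)
    (hmin : ∀ γ ∈ valueSet f,
      (Finset.univ.filter (fun x : F => f.eval x = γ₀)).card ≤
        (Finset.univ.filter (fun x : F => f.eval x = γ)).card) :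
    γ₀ = 0 := by
  have := Fact.mk hp
  have hchar : CharP F p := by
    obtain ⟨p', hp'⟩ := CharP.exists F
    obtain ⟨m, hp'2, hm⟩ := FiniteField.card F p'
    have : p' = p := by
      have h2 : p' ∣ p ^ n := by rw [← hcard, hm]; exact dvd_pow_self _ m.ne_zero
      exact (Nat.prime_dvd_prime_iff_eq hp'2 hp).1 (hp'2.dvd_of_dvd_pow h2)
    rwa [← this]
  obtain ⟨h0, hadd, hneg, hsmul⟩ := hU
  have hk0 : k ≠ 0 := by rintro rfl; rw [zero_dvd_iff] at hk; omega
  have hpk1 : 1 < p ^ k := Nat.one_lt_pow hk0 hp.one_lt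
  have hpn : p ^ k - 1 ∣ p ^ n - 1 := by
    obtain ⟨m, rfl⟩ := hk
    rw [pow_mul]
    simpa using Nat.sub_dvd_pow_sub_pow (p ^ k) 1 m
  obtain ⟨s, hs⟩ := hpn
  obtain ⟨g, hg⟩ := IsCyclic.exists_ofOrder_eq_natCard (α := Fˣ)
  rw [Nat.card_eq_fintype_card, Fintype.card_units, hcard] at hg
  have hpn1 : 1 < p ^ n := Nat.one_lt_pow hn.ne' hp.one_lt
  have hs0 : s ≠ 0 := by rintro rfl; omega
  have hgp : IsPrimitiveRoot (g : F) (p ^ n - 1) := by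
    rw [IsPrimitiveRoot.coe_units_iff, ← hg]; exact IsPrimitiveRoot.orderOf g
  have hc : IsPrimitiveRoot ((g : F) ^ s) (p ^ k - 1) :=
    hgp.pow (by omega) (by rw [hs, mul_comm])
  set c : F := (g : F) ^ s with hcdef
  have hc0 : c ≠ 0 := pow_ne_zero _ g.ne_zero
  have hcp : c ^ p ^ k = c := by
    rw [← Nat.sub_add_cancel hpk1.le, pow_succ, hc.pow_eq_one, one_mul]
  obtain ⟨j, hj⟩ := hvd
  have hζ : IsPrimitiveRoot (c ^ j) v := hc.pow (by omega) (by rw [hj, mul_comm])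
  obtain ⟨-, hM1, hM⟩ := aux_M p k hp U c hc.eq_orderOf.symm hc0 h0 hadd hneg
    (hsmul c hcp) (hsmul c⁻¹ (by rw [inv_pow, hcp])) _ rfl
  have hexp := aux_T v hv U _ hζ h0 (hsmul _ (by rw [← pow_mul, mul_comm, pow_mul, hcp]))
  obtain ⟨hT0, hT1, hTs⟩ := aux_Tcoef v _ hv _ _ hexp hM1 hM
  have h0V : (0 : F) ∈ U.image (fun u => u ^ v) :=
    Finset.mem_image.2 ⟨0, h0, by simp; omega⟩
  have h1V : (1 : F) ∈ U.image (fun u => u ^ v) :=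
    Finset.mem_image.2 ⟨1, h1, by simp⟩
  have hd := stmt_core p n k v hp hn hk hv ⟨j, hj⟩ F hcard _ _ rfl h0V h1V hT0 hT1 hTs hUv
    hnotfield f hf.1 hf.2
  have h0f : 0 ∈ valueSet f := by rw [hf.2]; exact h0V
  exact aux_final f hf.1 (by rw [hf.2]; exact hUv) h0f hd γ₀ hγ₀ (hmin 0 h0f)
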